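/- arXiv:1510.00504 — 2 statements merged into one kernel-verified Lean document; each statement's English description precedes it below -/
import Mathlib

section
/- Let Σ ⊆ H be a nonempty cone and let f : H → ℝ be continuous and coercive (f(x) → +∞ as ‖x‖ → +∞). Let t > f(0) be a real number such that the level set L(f,t) := {y ∈ H : f(y) ≤ t} is convex, and set A := L(f,t) ∩ Σ. Then δ_Σ(‖·‖_A) ≥ δ_Σ(f), where for a regularizer g : H → ℝ∪{+∞}, δ_Σ(g) := inf_{z ∈ T_g(Σ)\{0}} sup_{x ∈ Σ\{0}} δ_Σ^{cone}(x,z). -/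
open scoped RealInnerProductSpace Pointwise ENNReal
open Metric

variable {H : Type*} [NormedAddCommGroup H] [InnerProductSpace ℝ H]

noncomputable def atomicNorm (A : Set H) (x : H) : ℝ≥0∞ :=
  ⨅ t : {t : ℝ // 0 ≤ t ∧ x ∈ t • closure (convexHull ℝ A)}, ENNReal.ofReal (t : ℝ)

noncomputable def coneNorm (S : Set H) (x : H) : ℝ≥0∞ :=
  atomicNorm (S ∩ sphere (0 : H) 1) x

noncomputable def deltaUoS (S : Set H) (x z : H) : ℝ :=
  if coneNorm S (x + z) = ⊤ then 0
  else (-⟪x, z⟫) /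
    (‖x‖ * Real.sqrt ((coneNorm S (x + z)).toReal ^ 2 - ‖x‖ ^ 2 - 2 * ⟪x, z⟫))

noncomputable def deltaCone (S : Set H) (x z : H) : ℝ :=
  if coneNorm S (x + z) = ⊤ then 0
  else (-2 * ⟪x, z⟫) / ((coneNorm S (x + z)).toReal ^ 2 - 2 * ⟪x, z⟫)

def descentSet (S : Set H) (f : H → EReal) : Set H := {z : H | ∃ x ∈ S, f (x + z) ≤ f x}

noncomputable def deltaAdmUoS (S T : Set H) : EReal :=
  ⨅ z : {z : H // z ∈ T ∧ z ≠ 0}, ⨆ x : {x : H // x ∈ S ∧ x ≠ 0},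
    ((deltaUoS S (x : H) (z : H) : ℝ) : EReal)

noncomputable def deltaAdmCone (S T : Set H) : EReal :=
  ⨅ z : {z : H // z ∈ T ∧ z ≠ 0}, ⨆ x : {x : H // x ∈ S ∧ x ≠ 0},
    ((deltaCone S (x : H) (z : H) : ℝ) : EReal)

theorem atomicNorm_smul_le (A : Set H) {r : ℝ} (hr : 0 < r) (x : H) :
    atomicNorm A (r • x) ≤ ENNReal.ofReal r * atomicNorm A x := by
  unfold atomicNorm
  rw [ENNReal.mul_iInf_of_ne (by simpa using hr) ENNReal.ofReal_ne_top]
  refine le_iInf fun ⟨u, hu, hx⟩ => ?_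
  have hmem : r • x ∈ (r * u) • closure (convexHull ℝ A) := by
    rw [mul_smul]
    exact Set.smul_mem_smul_set hx
  rw [← ENNReal.ofReal_mul hr.le]
  exact iInf_le
    (fun s : {s : ℝ // 0 ≤ s ∧ r • x ∈ s • closure (convexHull ℝ A)} =>
      ENNReal.ofReal (s : ℝ)) ⟨r * u, by positivity, hmem⟩

theorem atomicNorm_smul (A : Set H) {r : ℝ} (hr : 0 < r) (x : H) :
    atomicNorm A (r • x) = ENNReal.ofReal r * atomicNorm A x := by
  refine le_antisymm (atomicNorm_smul_le A hr x) ?_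
  have h := atomicNorm_smul_le A (inv_pos.2 hr) (r • x)
  rw [inv_smul_smul₀ hr.ne'] at h
  calc ENNReal.ofReal r * atomicNorm A x
      ≤ ENNReal.ofReal r * (ENNReal.ofReal r⁻¹ * atomicNorm A (r • x)) := by gcongr
    _ = atomicNorm A (r • x) := by
      rw [← mul_assoc, ← ENNReal.ofReal_mul hr.le, mul_inv_cancel₀ hr.ne']
      simp

theorem atomicNorm_le_of_mem {A : Set H} {r : ℝ} (hr : 0 ≤ r) {x : H}
    (hx : x ∈ r • closure (convexHull ℝ A)) : atomicNorm A x ≤ ENNReal.ofReal r :=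
  iInf_le
    (fun s : {s : ℝ // 0 ≤ s ∧ x ∈ s • closure (convexHull ℝ A)} =>
      ENNReal.ofReal (s : ℝ)) ⟨r, hr, hx⟩

theorem inv_smul_mem_of_atomicNorm_lt {A L : Set H} (hAL : A ⊆ L) (hL : Convex ℝ L)
    (hLc : IsClosed L) (h0 : (0 : H) ∈ L) {s : ℝ} {y : H}
    (h : atomicNorm A y < ENNReal.ofReal s) : s⁻¹ • y ∈ L := by
  obtain ⟨⟨u, hu, w, hw, rfl⟩, hlt⟩ := iInf_lt_iff.1 h
  have hus : u < s := (ENNReal.ofReal_lt_ofReal_iff_of_nonneg hu).1 hlt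
  have hs : 0 < s := hu.trans_lt hus
  have hwL : w ∈ L := closure_minimal (convexHull_min hAL hL) hLc hw
  have hu' : s⁻¹ * u ≤ 1 := by
    rw [inv_mul_le_iff₀ hs]
    linarith
  simpa only [smul_smul] using hL.smul_mem_of_zero_mem h0 hwL ⟨by positivity, hu'⟩

theorem inv_smul_mem_of_atomicNorm_le {A L : Set H} (hAL : A ⊆ L) (hL : Convex ℝ L)
    (hLc : IsClosed L) (h0 : (0 : H) ∈ L) {s : ℝ} (hs : 0 < s) {y : H}
    (h : atomicNorm A y ≤ ENNReal.ofReal s) : s⁻¹ • y ∈ L := by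
  have hlim : Filter.Tendsto (fun u : ℝ => u⁻¹ • y) (nhdsWithin s (Set.Ioi s))
      (nhds (s⁻¹ • y)) :=
    ((tendsto_inv₀ hs.ne').mono_left nhdsWithin_le_nhds).smul_const y
  refine hLc.mem_of_tendsto hlim ?_
  filter_upwards [self_mem_nhdsWithin] with u hu
  exact inv_smul_mem_of_atomicNorm_lt hAL hL hLc h0
    (h.trans_lt ((ENNReal.ofReal_lt_ofReal_iff_of_nonneg hs.le).2 hu))

theorem deltaCone_smul_smul (S : Set H) {r : ℝ} (hr : 0 < r) (x z : H) :
    deltaCone S (r • x) (r • z) = deltaCone S x z := by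
  have hN : coneNorm S (r • x + r • z) = ENNReal.ofReal r * coneNorm S (x + z) := by
    rw [← smul_add]
    exact atomicNorm_smul _ hr _
  have hr0 : ENNReal.ofReal r ≠ 0 := by simpa using hr
  unfold deltaCone
  rw [hN]
  by_cases htop : coneNorm S (x + z) = ⊤
  · simp [htop, ENNReal.mul_top hr0]
  · rw [if_neg htop, if_neg (ENNReal.mul_ne_top ENNReal.ofReal_ne_top htop),
      ENNReal.toReal_mul, ENNReal.toReal_ofReal hr.le, real_inner_smul_left,
      real_inner_smul_right,
      ← mul_div_mul_left (-2 * ⟪x, z⟫) _ (pow_ne_zero 2 hr.ne')]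
    congr 1 <;> ring

theorem deltaAdmCone_le_of_forall_exists_smul_mem {S T T' : Set H}
    (hcone : ∀ t : ℝ, 0 ≤ t → ∀ x ∈ S, t • x ∈ S)
    (h : ∀ z ∈ T', z ≠ 0 → ∃ r : ℝ, 0 < r ∧ r • z ∈ T) :
    deltaAdmCone S T ≤ deltaAdmCone S T' := by
  refine le_iInf fun ⟨z, hz, hz0⟩ => ?_
  obtain ⟨r, hr, hrz⟩ := h z hz hz0
  refine (iInf_le _ ⟨r • z, hrz, smul_ne_zero hr.ne' hz0⟩).trans (iSup_le fun ⟨x, hx, hx0⟩ => ?_)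
  have hr' : 0 < r⁻¹ := inv_pos.2 hr
  have hδ : deltaCone S x (r • z) = deltaCone S (r⁻¹ • x) z := by
    rw [← deltaCone_smul_smul S hr (r⁻¹ • x), smul_inv_smul₀ hr.ne']
  change ((deltaCone S x (r • z) : ℝ) : EReal) ≤ _
  rw [hδ]
  exact le_iSup (fun y : {y : H // y ∈ S ∧ y ≠ 0} => ((deltaCone S (y : H) z : ℝ) : EReal))
    ⟨r⁻¹ • x, hcone _ hr'.le x hx, smul_ne_zero hr'.ne' hx0⟩

theorem exists_pos_lt_apply_smul {f : H → ℝ}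
    (hcoer : ∀ c : ℝ, ∃ R : ℝ, ∀ x : H, R ≤ ‖x‖ → c ≤ f x) (t : ℝ) {x : H} (hx : x ≠ 0) :
    ∃ r : ℝ, 0 < r ∧ t < f (r • x) := by
  obtain ⟨R, hR⟩ := hcoer (t + 1)
  have hx' : 0 < ‖x‖ := norm_pos_iff.2 hx
  refine ⟨(|R| + 1) / ‖x‖, by positivity, ?_⟩
  have hnorm : ‖((|R| + 1) / ‖x‖) • x‖ = |R| + 1 := by
    rw [norm_smul, Real.norm_of_nonneg (by positivity), div_mul_cancel₀ _ hx'.ne']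
  linarith [hR (((|R| + 1) / ‖x‖) • x) (by rw [hnorm]; linarith [le_abs_self R])]

theorem stmt6 [CompleteSpace H]
    (S : Set H) (hne : S.Nonempty) (hcone : ∀ t : ℝ, 0 ≤ t → ∀ x ∈ S, t • x ∈ S)
    (f : H → ℝ) (hf : Continuous f)
    (hcoer : ∀ c : ℝ, ∃ R : ℝ, ∀ x : H, R ≤ ‖x‖ → c ≤ f x)
    (t : ℝ) (ht : f 0 < t) (hconv : Convex ℝ {y : H | f y ≤ t}) :
    deltaAdmCone S {z : H | ∃ x ∈ S, f (x + z) ≤ f x} ≤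
      deltaAdmCone S {z : H | ∃ x ∈ S,
        atomicNorm ({y : H | f y ≤ t} ∩ S) (x + z) ≤
        atomicNorm ({y : H | f y ≤ t} ∩ S) x} := by
  have h0 : (0 : H) ∈ S := by
    obtain ⟨x, hx⟩ := hne
    simpa using hcone 0 le_rfl x hx
  have hLc : IsClosed {y : H | f y ≤ t} := isClosed_le hf continuous_const
  have hmem {x : H} (hx : x ∈ S) (hfx : f x ≤ t) :
      x ∈ closure (convexHull ℝ ({y : H | f y ≤ t} ∩ S)) :=
    subset_closure (subset_convexHull ℝ _ ⟨hfx, hx⟩)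
  refine deltaAdmCone_le_of_forall_exists_smul_mem hcone ?_
  rintro z ⟨x, hx, hxz⟩ hz0
  rcases eq_or_ne x 0 with rfl | hx0
  · obtain ⟨r, hr, hlt⟩ := exists_pos_lt_apply_smul hcoer t hz0
    have hzero : atomicNorm ({y : H | f y ≤ t} ∩ S) 0 ≤ ENNReal.ofReal 0 :=
      atomicNorm_le_of_mem le_rfl ⟨0, hmem h0 ht.le, by simp⟩
    rw [zero_add] at hxz
    have h := inv_smul_mem_of_atomicNorm_le Set.inter_subset_left hconv hLc ht.le
      (inv_pos.2 hr) (hxz.trans (hzero.trans (ENNReal.ofReal_le_ofReal (inv_pos.2 hr).le)))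
    rw [inv_inv] at h
    exact absurd hlt (not_lt.2 h)
  · obtain ⟨R, hR, hlt⟩ := exists_pos_lt_apply_smul hcoer t hx0
    have hcont : Continuous fun r : ℝ => f (r • x) := by fun_prop
    obtain ⟨r, ⟨hr0, -⟩, hrt⟩ := intermediate_value_Icc hR.le hcont.continuousOn
      (show t ∈ Set.Icc (f ((0 : ℝ) • x)) (f (R • x)) by
        rw [zero_smul]
        exact ⟨ht.le, hlt.le⟩)
    have hr : 0 < r := by
      refine hr0.lt_of_ne ?_
      rintro rfl
      simp only [zero_smul] at hrt
      exact ht.ne hrt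
    have hnorm : atomicNorm ({y : H | f y ≤ t} ∩ S) x ≤ ENNReal.ofReal r⁻¹ :=
      atomicNorm_le_of_mem (inv_pos.2 hr).le
        ⟨r • x, hmem (hcone r hr.le x hx) hrt.le, inv_smul_smul₀ hr.ne' x⟩
    have h := inv_smul_mem_of_atomicNorm_le Set.inter_subset_left hconv hLc ht.le
      (inv_pos.2 hr) (hxz.trans hnorm)
    rw [inv_inv, smul_add] at h
    exact ⟨r, hr, r • x, hcone r hr.le x hx, h.trans hrt.ge⟩
end

section
/- Assume 1 ≤ K ≤ |G|. Then δ_{Σ_K}(‖·‖_A) ≥ 1/sqrt(2), where δ_{Σ_K}(‖·‖_A) := inf_{z ∈ T\{0}} sup_{x ∈ Σ_K\{0}} (−⟨x,z⟩)/(‖x‖·sqrt(‖x+z‖_{Σ_K}² − ‖x‖² − 2⟨x,z⟩)), the infimum being over the nonzero descent vectors T\{0} with T := {z ∈ H : ‖x+z‖_A ≤ ‖x‖_A for some x ∈ Σ_K}, and the supremand interpreted as 0 when ‖x+z‖_{Σ_K} = +∞. -/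
open scoped RealInnerProductSpace Pointwise ENNReal
open Metric

variable {H : Type*} [NormedAddCommGroup H] [InnerProductSpace ℝ H]

noncomputable def gproj (e : ℕ → H) (g : Finset ℕ) (x : H) : H :=
  ∑ i ∈ g, ⟪x, e i⟫ • e i

noncomputable def gprojS (e : ℕ → H) (Hs : Finset (Finset ℕ)) (x : H) : H :=
  ∑ g ∈ Hs, gproj e g x

def Egrp (e : ℕ → H) (G : Finset (Finset ℕ)) : Set H :=
  (Submodule.span ℝ (e '' (G.biUnion id : Finset ℕ)) : Set H)

def SigmaK (e : ℕ → H) (G : Finset (Finset ℕ)) (K : ℕ) : Set H :=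
  {x : H | ∃ H' ⊆ G, H'.card ≤ K ∧ x = gprojS e H' x}

noncomputable def groupNormR (e : ℕ → H) (G : Finset (Finset ℕ)) (x : H) : ℝ :=
  ∑ g ∈ G, ‖gproj e g x‖

open Classical in
noncomputable def groupNorm (e : ℕ → H) (G : Finset (Finset ℕ)) (x : H) : ℝ≥0∞ :=
  if x ∈ Egrp e G then ENNReal.ofReal (groupNormR e G x) else ⊤

noncomputable def dualNorm (e : ℕ → H) (G : Finset (Finset ℕ)) (x : H) : ℝ :=
  sSup ((fun g => ‖gproj e g x‖) '' (G : Set (Finset ℕ)))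

theorem exists_top_card_subset {ι : Type*} [DecidableEq ι] (G : Finset ι) (a : ι → ℝ)
    (ha : ∀ g, 0 ≤ a g) (K : ℕ) (hK : K ≤ G.card) :
    ∃ F ⊆ G, F.card = K ∧ ∃ τ : ℝ, 0 ≤ τ ∧ (∀ g ∈ F, τ ≤ a g) ∧ ∀ g ∈ G \ F, a g ≤ τ := by
  induction K with
  | zero =>
    refine ⟨∅, by simp, rfl, ∑ g ∈ G, a g, Finset.sum_nonneg fun g _ => ha g, by simp, ?_⟩
    intro g hg
    exact Finset.single_le_sum (fun g _ => ha g) (Finset.mem_sdiff.1 hg).1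
  | succ K ih =>
    obtain ⟨F, hFG, hF, τ, -, hτF, hτ⟩ := ih (by omega)
    have hne : (G \ F).Nonempty := by
      rw [← Finset.card_pos, Finset.card_sdiff_of_subset hFG]
      omega
    obtain ⟨m, hm, hmax⟩ := Finset.exists_max_image (G \ F) a hne
    have hm' := Finset.mem_sdiff.1 hm
    refine ⟨insert m F, Finset.insert_subset hm'.1 hFG, by
      rw [Finset.card_insert_of_notMem hm'.2, hF], a m, ha m, ?_, ?_⟩
    · intro g hg
      rcases Finset.mem_insert.1 hg with rfl | hg
      · exact le_rfl
      · exact (hτ m hm).trans (hτF g hg)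
    · intro g hg
      simp only [Finset.mem_sdiff, Finset.mem_insert, not_or] at hg
      exact hmax g (Finset.mem_sdiff.2 ⟨hg.1, hg.2.2⟩)

theorem sum_mul_le_mul_sum_of_threshold {ι : Type*} [DecidableEq ι] {G F : Finset ι}
    (hFG : F ⊆ G) {a d : ι → ℝ} {B τ : ℝ} (hτ0 : 0 ≤ τ) (hτF : ∀ g ∈ F, τ ≤ a g)
    (hτ : ∀ g ∈ G \ F, a g ≤ τ) (hd : ∀ g ∈ G, 0 ≤ d g) (hdB : ∀ g ∈ G, d g ≤ B)
    (hsum : ∑ g ∈ G, d g ≤ F.card * B) :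
    ∑ g ∈ G, d g * a g ≤ B * ∑ g ∈ F, a g := by
  have h1 : ∑ g ∈ F, (d g - B) * a g ≤ ∑ g ∈ F, (d g - B) * τ :=
    Finset.sum_le_sum fun g hg =>
      mul_le_mul_of_nonpos_left (hτF g hg) (sub_nonpos.2 (hdB g (hFG hg)))
  have h2 : ∑ g ∈ G \ F, d g * a g ≤ ∑ g ∈ G \ F, d g * τ :=
    Finset.sum_le_sum fun g hg =>
      mul_le_mul_of_nonneg_left (hτ g hg) (hd g (Finset.mem_sdiff.1 hg).1)
  have h3 := Finset.sum_sdiff (f := fun g => d g * a g) hFG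
  have h4 := Finset.sum_sdiff (f := d) hFG
  simp only [sub_mul, Finset.sum_sub_distrib, ← Finset.mul_sum, ← Finset.sum_mul,
    Finset.sum_const, nsmul_eq_mul] at h1 h2
  nlinarith

/-- If the `a`-threshold set `F` and the `b`-threshold set `T` both have `K` elements and the mass
of `b` off `T` is at most its mass on `T`, then the pairing of `a` with `b` off `T` is controlled
by the Euclidean norms of `b` on `T` and `a` on `F`. -/
theorem sum_sdiff_mul_le_sqrt_mul_sqrt {ι : Type*} [DecidableEq ι] {G F T : Finset ι}
    (hFG : F ⊆ G) (hTG : T ⊆ G) {a b : ι → ℝ} {K : ℕ} (hK : 0 < K) (hF : F.card = K)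
    (hT : T.card = K) {τ σ : ℝ} (ha : ∀ g, 0 ≤ a g) (hb : ∀ g, 0 ≤ b g)
    (hτ0 : 0 ≤ τ) (hτF : ∀ g ∈ F, τ ≤ a g) (hτ : ∀ g ∈ G \ F, a g ≤ τ)
    (hσT : ∀ g ∈ T, σ ≤ b g) (hσ : ∀ g ∈ G \ T, b g ≤ σ)
    (hmass : ∑ g ∈ G \ T, b g ≤ ∑ g ∈ T, b g) :
    ∑ g ∈ G \ T, a g * b g ≤ √(∑ g ∈ T, b g ^ 2) * √(∑ g ∈ F, a g ^ 2) := by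
  have hB : 0 ≤ ∑ g ∈ T, b g := Finset.sum_nonneg fun g _ => hb g
  have hA : 0 ≤ ∑ g ∈ F, a g := Finset.sum_nonneg fun g _ => ha g
  have hK' : (0 : ℝ) < K := by exact_mod_cast hK
  have hrestrict : ∀ f : ι → ℝ, ∑ g ∈ G, (if g ∈ T then 0 else f g) = ∑ g ∈ G \ T, f g := by
    intro f
    rw [← Finset.sum_sdiff hTG]
    rw [Finset.sum_congr (s₁ := T) rfl (g := fun _ => (0 : ℝ)) fun g hg => if_pos hg,
      Finset.sum_const_zero, add_zero]
    exact Finset.sum_congr rfl fun g hg => if_neg (Finset.mem_sdiff.1 hg).2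
  have key := sum_mul_le_mul_sum_of_threshold (G := G) (F := F) hFG (a := a)
    (d := fun g => if g ∈ T then 0 else K * b g) (B := ∑ g ∈ T, b g) hτ0 hτF hτ
    (fun g _ => by
      split_ifs
      · exact le_rfl
      · exact mul_nonneg hK'.le (hb g))
    (fun g hg => by
      split_ifs with h
      · exact hB
      · have h1 := Finset.card_nsmul_le_sum T b σ hσT
        rw [hT, nsmul_eq_mul] at h1
        exact (mul_le_mul_of_nonneg_left (hσ g (Finset.mem_sdiff.2 ⟨hg, h⟩)) hK'.le).trans h1)
    (by
      rw [hrestrict, ← Finset.mul_sum, hF]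
      exact mul_le_mul_of_nonneg_left hmass hK'.le)
  simp only [ite_mul, zero_mul] at key
  rw [hrestrict] at key
  have h1 : ∑ g ∈ G \ T, K * b g * a g = K * ∑ g ∈ G \ T, a g * b g := by
    rw [Finset.mul_sum]
    exact Finset.sum_congr rfl fun g _ => by ring
  rw [h1] at key
  have hbound : ∀ (S : Finset ι) (f : ι → ℝ), S.card = K →
      ∑ g ∈ S, f g ≤ √K * √(∑ g ∈ S, f g ^ 2) := by
    intro S f hS
    rw [← Real.sqrt_mul hK'.le]
    apply Real.le_sqrt_of_sq_le
    have := sq_sum_le_card_mul_sum_sq (s := S) (f := f)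
    rwa [hS] at this
  have h2 := mul_le_mul (hbound T b hT) (hbound F a hF) hA (by positivity)
  have h3 : √(K : ℝ) * √(K : ℝ) = K := Real.mul_self_sqrt hK'.le
  refine le_of_mul_le_mul_left (key.trans (h2.trans_eq ?_)) hK'
  linear_combination (√(∑ g ∈ T, b g ^ 2) * √(∑ g ∈ F, a g ^ 2)) * h3

theorem gproj_add (e : ℕ → H) (A : Finset ℕ) (x y : H) :
    gproj e A (x + y) = gproj e A x + gproj e A y := by
  simp only [gproj, inner_add_left, add_smul, Finset.sum_add_distrib]

theorem gproj_smul (e : ℕ → H) (A : Finset ℕ) (c : ℝ) (x : H) :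
    gproj e A (c • x) = c • gproj e A x := by
  simp only [gproj, real_inner_smul_left, mul_smul, Finset.smul_sum]

theorem inner_gproj_basis {e : ℕ → H} (he : Orthonormal ℝ e) (A : Finset ℕ) (x : H) (i : ℕ) :
    ⟪gproj e A x, e i⟫ = if i ∈ A then ⟪x, e i⟫ else 0 := by
  simp [gproj, sum_inner, real_inner_smul_left, orthonormal_iff_ite.1 he]

theorem gproj_gproj {e : ℕ → H} (he : Orthonormal ℝ e) (A B : Finset ℕ) (x : H) :
    gproj e A (gproj e B x) = gproj e (A ∩ B) x := by
  simp only [gproj.eq_1 e A, inner_gproj_basis he, ite_smul, zero_smul, Finset.sum_ite_mem]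
  rfl

theorem inner_gproj_left (e : ℕ → H) (A : Finset ℕ) (x y : H) :
    ⟪gproj e A x, y⟫ = ⟪x, gproj e A y⟫ := by
  simp only [gproj, sum_inner, inner_sum, real_inner_smul_left, real_inner_smul_right]
  exact Finset.sum_congr rfl fun i _ => by rw [real_inner_comm y, mul_comm]

theorem inner_gproj_gproj {e : ℕ → H} (he : Orthonormal ℝ e) (A : Finset ℕ) (x y : H) :
    ⟪gproj e A x, gproj e A y⟫ = ⟪x, gproj e A y⟫ := by
  rw [inner_gproj_left, gproj_gproj he, Finset.inter_self]

theorem norm_gproj_sq {e : ℕ → H} (he : Orthonormal ℝ e) (A : Finset ℕ) (x : H) :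
    ‖gproj e A x‖ ^ 2 = ⟪x, gproj e A x⟫ := by
  rw [← real_inner_self_eq_norm_sq, inner_gproj_gproj he]

theorem gprojS_eq_gproj (e : ℕ → H) {F : Finset (Finset ℕ)}
    (hF : (F : Set (Finset ℕ)).Pairwise fun g g' => Disjoint g g') (x : H) :
    gprojS e F x = gproj e (F.biUnion id) x :=
  (Finset.sum_biUnion hF).symm

theorem gprojS_smul (e : ℕ → H) (F : Finset (Finset ℕ)) (c : ℝ) (x : H) :
    gprojS e F (c • x) = c • gprojS e F x := by
  simp only [gprojS, gproj_smul, Finset.smul_sum]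

theorem gprojS_gprojS {e : ℕ → H} (he : Orthonormal ℝ e) {F : Finset (Finset ℕ)}
    (hF : (F : Set (Finset ℕ)).Pairwise fun g g' => Disjoint g g') (x : H) :
    gprojS e F (gprojS e F x) = gprojS e F x := by
  rw [gprojS_eq_gproj e hF, gprojS_eq_gproj e hF, gproj_gproj he, Finset.inter_self]

theorem inner_gprojS_self {e : ℕ → H} (he : Orthonormal ℝ e) {F : Finset (Finset ℕ)}
    (hF : (F : Set (Finset ℕ)).Pairwise fun g g' => Disjoint g g') (x : H) :
    ⟪gprojS e F x, x⟫ = ‖gprojS e F x‖ ^ 2 := by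
  rw [gprojS_eq_gproj e hF, norm_gproj_sq he, real_inner_comm]

theorem norm_gprojS_sq {e : ℕ → H} (he : Orthonormal ℝ e) {F : Finset (Finset ℕ)}
    (hF : (F : Set (Finset ℕ)).Pairwise fun g g' => Disjoint g g') (x : H) :
    ‖gprojS e F x‖ ^ 2 = ∑ g ∈ F, ‖gproj e g x‖ ^ 2 := by
  rw [← inner_gprojS_self he hF, gprojS, sum_inner]
  exact Finset.sum_congr rfl fun g _ => by rw [norm_gproj_sq he, real_inner_comm]

theorem norm_gprojS {e : ℕ → H} (he : Orthonormal ℝ e) {F : Finset (Finset ℕ)}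
    (hF : (F : Set (Finset ℕ)).Pairwise fun g g' => Disjoint g g') (x : H) :
    ‖gprojS e F x‖ = √(∑ g ∈ F, ‖gproj e g x‖ ^ 2) := by
  rw [← norm_gprojS_sq he hF, Real.sqrt_sq (norm_nonneg _)]

theorem gprojS_eq_self_of_mem_Egrp {e : ℕ → H} (he : Orthonormal ℝ e) {G : Finset (Finset ℕ)}
    (hG : (G : Set (Finset ℕ)).Pairwise fun g g' => Disjoint g g') {x : H} (hx : x ∈ Egrp e G) :
    gprojS e G x = x := by
  rw [gprojS_eq_gproj e hG]
  refine Submodule.span_induction ?_ ?_ ?_ ?_ hx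
  · rintro _ ⟨i, hi, rfl⟩
    simp only [gproj, orthonormal_iff_ite.1 he, ite_smul, one_smul, zero_smul]
    rw [Finset.sum_ite_eq, if_pos (Finset.mem_coe.1 hi)]
  · simp [gproj]
  · intro x y _ _ hx hy
    rw [gproj_add, hx, hy]
  · intro c x _ hx
    rw [gproj_smul, hx]

theorem gprojS_mem_Egrp (e : ℕ → H) {F G : Finset (Finset ℕ)} (hFG : F ⊆ G) (x : H) :
    gprojS e F x ∈ Egrp e G := by
  refine Submodule.sum_mem _ fun g hg => Submodule.sum_mem _ fun i hi =>
    Submodule.smul_mem _ _ (Submodule.subset_span ⟨i, ?_, rfl⟩)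
  exact Finset.mem_coe.2 (Finset.mem_biUnion.2 ⟨g, hFG hg, hi⟩)

theorem gprojS_mem_SigmaK {e : ℕ → H} (he : Orthonormal ℝ e) {F G : Finset (Finset ℕ)} {K : ℕ}
    (hG : (G : Set (Finset ℕ)).Pairwise fun g g' => Disjoint g g') (hFG : F ⊆ G)
    (hF : F.card ≤ K) (x : H) : gprojS e F x ∈ SigmaK e G K :=
  ⟨F, hFG, hF, (gprojS_gprojS he (hG.mono (Finset.coe_subset.2 hFG)) x).symm⟩

theorem smul_mem_SigmaK {e : ℕ → H} {G : Finset (Finset ℕ)} {K : ℕ} {x : H}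
    (hx : x ∈ SigmaK e G K) (c : ℝ) : c • x ∈ SigmaK e G K := by
  obtain ⟨F, hFG, hF, h⟩ := hx
  exact ⟨F, hFG, hF, by rw [gprojS_smul, ← h]⟩

/-- Descent vectors of the group norm at a group-sparse point carry at most as much group norm off
some group-sparse support as on it. -/
theorem exists_sum_sdiff_le_of_groupNorm_le {e : ℕ → H} (he : Orthonormal ℝ e)
    {G : Finset (Finset ℕ)} (hG : (G : Set (Finset ℕ)).Pairwise fun g g' => Disjoint g g')
    {K : ℕ} {x z : H} (hx : x ∈ SigmaK e G K) (hxz : groupNorm e G (x + z) ≤ groupNorm e G x) :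
    z ∈ Egrp e G ∧ ∃ F ⊆ G, F.card ≤ K ∧
      ∑ g ∈ G \ F, ‖gproj e g z‖ ≤ ∑ g ∈ F, ‖gproj e g z‖ := by
  obtain ⟨F, hFG, hF, hxF⟩ := hx
  have hxE : x ∈ Egrp e G := hxF ▸ gprojS_mem_Egrp e hFG x
  rw [groupNorm, groupNorm, if_pos hxE] at hxz
  split_ifs at hxz with hxzE
  swap
  · simp at hxz
  have hzE : z ∈ Egrp e G := by
    have := Submodule.sub_mem _ hxzE hxE
    rwa [add_sub_cancel_left] at this
  refine ⟨hzE, F, hFG, hF, ?_⟩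
  have hnonneg : 0 ≤ groupNormR e G x := Finset.sum_nonneg fun _ _ => norm_nonneg _
  rw [ENNReal.ofReal_le_ofReal_iff hnonneg, groupNormR,
    groupNormR, ← Finset.sum_sdiff hFG, ← Finset.sum_sdiff hFG] at hxz
  have hoff : ∀ g ∈ G \ F, gproj e g x = 0 := by
    intro g hg
    obtain ⟨hgG, hgF⟩ := Finset.mem_sdiff.1 hg
    rw [hxF, gprojS_eq_gproj e (hG.mono (Finset.coe_subset.2 hFG)), gproj_gproj he,
      Finset.disjoint_iff_inter_eq_empty.1, gproj, Finset.sum_empty]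
    rw [Finset.disjoint_biUnion_right]
    intro g' hg'
    exact hG hgG (hFG hg') fun h => hgF (h ▸ hg')
  have h1 : ∑ g ∈ G \ F, ‖gproj e g (x + z)‖ = ∑ g ∈ G \ F, ‖gproj e g z‖ :=
    Finset.sum_congr rfl fun g hg => by rw [gproj_add, hoff g hg, zero_add]
  have h2 : ∑ g ∈ G \ F, ‖gproj e g x‖ = 0 :=
    Finset.sum_eq_zero fun g hg => by rw [hoff g hg, norm_zero]
  have h3 : ∑ g ∈ F, ‖gproj e g x‖ ≤
      ∑ g ∈ F, ‖gproj e g (x + z)‖ + ∑ g ∈ F, ‖gproj e g z‖ := by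
    rw [← Finset.sum_add_distrib]
    refine Finset.sum_le_sum fun g _ => ?_
    rw [gproj_add]
    exact norm_le_add_norm_add _ _
  linarith

/-- Bound on the atomic norm of the group-sparse model off a `K`-group threshold set. -/
theorem coneNorm_gprojS_sdiff_le [CompleteSpace H] {e : ℕ → H} (he : Orthonormal ℝ e)
    {G T : Finset (Finset ℕ)} (hG : (G : Set (Finset ℕ)).Pairwise fun g g' => Disjoint g g')
    {K : ℕ} (hK : 0 < K) (hKG : K ≤ G.card) (hTG : T ⊆ G) (hT : T.card = K) {z : H} {σ : ℝ}
    (hσT : ∀ g ∈ T, σ ≤ ‖gproj e g z‖) (hσ : ∀ g ∈ G \ T, ‖gproj e g z‖ ≤ σ)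
    (hmass : ∑ g ∈ G \ T, ‖gproj e g z‖ ≤ ∑ g ∈ T, ‖gproj e g z‖)
    (hz : gprojS e T z ≠ 0) :
    coneNorm (SigmaK e G K) (gprojS e (G \ T) z) ≤ ENNReal.ofReal ‖gprojS e T z‖ := by
  set R := ‖gprojS e T z‖ with hR
  have hR0 : 0 < R := norm_pos_iff.2 hz
  set C := closure (convexHull ℝ (SigmaK e G K ∩ sphere (0 : H) 1)) with hC
  have hmemC : ∀ v ∈ SigmaK e G K, v ≠ 0 → ‖v‖⁻¹ • v ∈ C := by
    intro v hv hv0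
    refine subset_closure (subset_convexHull ℝ _ ⟨smul_mem_SigmaK hv _, ?_⟩)
    rw [mem_sphere_zero_iff_norm, norm_smul, norm_inv, norm_norm,
      inv_mul_cancel₀ (norm_ne_zero_iff.2 hv0)]
  suffices h : R⁻¹ • gprojS e (G \ T) z ∈ C from
    iInf_le_of_le (⟨R, hR0.le, (Set.mem_smul_set_iff_inv_smul_mem₀ hR0.ne' _ _).2 h⟩ :
      {t : ℝ // 0 ≤ t ∧ gprojS e (G \ T) z ∈ t • C}) le_rfl
  by_contra hnot
  obtain ⟨f, s, hfC, hfs⟩ :=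
    geometric_hahn_banach_closed_point (convex_convexHull ℝ _).closure isClosed_closure hnot
  have hfS : ∀ v ∈ SigmaK e G K, v ≠ 0 → f v < s * ‖v‖ := by
    intro v hv hv0
    have h := hfC _ (hmemC v hv hv0)
    rw [map_smul, smul_eq_mul, inv_mul_lt_iff₀ (norm_pos_iff.2 hv0)] at h
    linarith
  have hs : 0 < s := by
    have hm := gprojS_mem_SigmaK he hG hTG hT.le z
    have h1 := hfS _ hm hz
    have h2 := hfS _ (smul_mem_SigmaK hm (-1)) (by simpa using hz)
    rw [map_smul, norm_smul] at h2
    simp only [smul_eq_mul, norm_neg, norm_one, one_mul] at h2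
    have : 0 < s * R := by linarith
    exact pos_of_mul_pos_left this hR0.le
  set p := (InnerProductSpace.toDual ℝ H).symm f with hp
  have hpf : ∀ y, ⟪p, y⟫ = f y := fun y => InnerProductSpace.toDual_symm_apply
  obtain ⟨F, hFG, hF, τ, hτ0, hτF, hτ⟩ :=
    exists_top_card_subset G (fun g => ‖gproj e g p‖) (fun _ => norm_nonneg _) K hKG
  have hFd := hG.mono (Finset.coe_subset.2 hFG)
  have hv : ‖gprojS e F p‖ ≤ s := by
    by_cases h0 : gprojS e F p = 0
    · rw [h0, norm_zero]
      exact hs.le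
    · have h := hfS _ (gprojS_mem_SigmaK he hG hFG hF.le p) h0
      rw [← hpf, real_inner_comm, inner_gprojS_self he hFd, sq] at h
      exact le_of_mul_le_mul_right h.le (norm_pos_iff.2 h0)
  have hbound : f (gprojS e (G \ T) z) ≤ R * s := by
    calc f (gprojS e (G \ T) z) = ∑ g ∈ G \ T, ⟪gproj e g p, gproj e g z⟫ := by
          rw [← hpf, gprojS, inner_sum]
          exact Finset.sum_congr rfl fun g _ => (inner_gproj_gproj he g p z).symm
      _ ≤ ∑ g ∈ G \ T, ‖gproj e g p‖ * ‖gproj e g z‖ :=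
          Finset.sum_le_sum fun g _ => real_inner_le_norm _ _
      _ ≤ √(∑ g ∈ T, ‖gproj e g z‖ ^ 2) * √(∑ g ∈ F, ‖gproj e g p‖ ^ 2) :=
          sum_sdiff_mul_le_sqrt_mul_sqrt hFG hTG hK hF hT (fun _ => norm_nonneg _)
            (fun _ => norm_nonneg _) hτ0 hτF hτ hσT hσ hmass
      _ = R * ‖gprojS e F p‖ := by
          rw [hR, norm_gprojS he (hG.mono (Finset.coe_subset.2 hTG)), norm_gprojS he hFd]
      _ ≤ R * s := mul_le_mul_of_nonneg_left hv hR0.le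
  rw [map_smul, smul_eq_mul, lt_inv_mul_iff₀ hR0] at hfs
  linarith

theorem one_div_sqrt_two_le_deltaUoS {S : Set H} {x z : H} (hx : x ≠ 0)
    (hxz : -⟪x, z⟫ = ‖x‖ ^ 2) (hS : coneNorm S (x + z) ≤ ENNReal.ofReal ‖x‖) :
    1 / √2 ≤ deltaUoS S x z := by
  have hx0 : 0 < ‖x‖ := norm_pos_iff.2 hx
  rw [deltaUoS, if_neg (ne_top_of_le_ne_top ENNReal.ofReal_ne_top hS)]
  have hN : (coneNorm S (x + z)).toReal ≤ ‖x‖ :=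
    ENNReal.toReal_le_of_le_ofReal hx0.le hS
  have hN0 : 0 ≤ (coneNorm S (x + z)).toReal := ENNReal.toReal_nonneg
  have hpos : 0 < (coneNorm S (x + z)).toReal ^ 2 - ‖x‖ ^ 2 - 2 * ⟪x, z⟫ := by nlinarith
  have hle : √((coneNorm S (x + z)).toReal ^ 2 - ‖x‖ ^ 2 - 2 * ⟪x, z⟫) ≤ √2 * ‖x‖ := by
    rw [Real.sqrt_le_iff, mul_pow, Real.sq_sqrt zero_le_two]
    exact ⟨by positivity, by nlinarith⟩
  rw [hxz, div_le_div_iff₀ (by positivity) (mul_pos hx0 (Real.sqrt_pos.2 hpos)), one_mul]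
  nlinarith

theorem stmt13 [CompleteSpace H]
    (e : ℕ → H) (he : Orthonormal ℝ e)
    (htot : (Submodule.span ℝ (Set.range e)).topologicalClosure = ⊤)
    (G : Finset (Finset ℕ)) (hGne : ∀ g ∈ G, g.Nonempty)
    (hGdisj : (G : Set (Finset ℕ)).Pairwise fun g g' => Disjoint g g')
    (K : ℕ) (hK1 : 1 ≤ K) (hKG : K ≤ G.card) :
    ((1 / Real.sqrt 2 : ℝ) : EReal) ≤
      deltaAdmUoS (SigmaK e G K)
        {z : H | ∃ x ∈ SigmaK e G K, groupNorm e G (x + z) ≤ groupNorm e G x} := by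
  refine le_iInf ?_
  rintro ⟨z, ⟨x, hx, hxz⟩, hz0⟩
  obtain ⟨hzE, F, hFG, hF, hFz⟩ := exists_sum_sdiff_le_of_groupNorm_le he hGdisj hx hxz
  obtain ⟨T, hTG, hT, σ, hσ0, hσT, hσ⟩ :=
    exists_top_card_subset G (fun g => ‖gproj e g z‖) (fun _ => norm_nonneg _) K hKG
  have hTd := hGdisj.mono (Finset.coe_subset.2 hTG)
  have hFT : ∑ g ∈ F, ‖gproj e g z‖ ≤ ∑ g ∈ T, ‖gproj e g z‖ := by
    have h := sum_mul_le_mul_sum_of_threshold hTG (d := fun g => if g ∈ F then 1 else 0) (B := 1)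
      hσ0 hσT hσ (fun g _ => by split_ifs <;> norm_num)
      (fun g _ => by split_ifs <;> norm_num)
      (by
        rw [Finset.sum_ite_mem, Finset.inter_eq_right.2 hFG, Finset.sum_const, hT]
        simpa using hF)
    simpa only [ite_mul, one_mul, zero_mul, Finset.sum_ite_mem, Finset.inter_eq_right.2 hFG]
      using h
  have hsplitF := Finset.sum_sdiff (f := fun g => ‖gproj e g z‖) hFG
  have hsplitT := Finset.sum_sdiff (f := fun g => ‖gproj e g z‖) hTG
  have hmass : ∑ g ∈ G \ T, ‖gproj e g z‖ ≤ ∑ g ∈ T, ‖gproj e g z‖ := by linarith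
  have hzsplit : gprojS e (G \ T) z + gprojS e T z = z :=
    (Finset.sum_sdiff hTG).trans (gprojS_eq_self_of_mem_Egrp he hGdisj hzE)
  have hzT : gprojS e T z ≠ 0 := by
    intro h
    have h1 := norm_gprojS_sq he hTd z
    rw [h, norm_zero, zero_pow two_ne_zero, eq_comm,
      Finset.sum_eq_zero_iff_of_nonneg fun _ _ => sq_nonneg _] at h1
    have h2 : ∑ g ∈ T, ‖gproj e g z‖ = 0 :=
      Finset.sum_eq_zero fun g hg => pow_eq_zero_iff two_ne_zero |>.1 (h1 g hg)
    have h3 := norm_sum_le (G \ T) fun g => gproj e g z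
    rw [h, add_zero] at hzsplit
    change ‖gprojS e (G \ T) z‖ ≤ _ at h3
    rw [hzsplit] at h3
    exact hz0 (norm_le_zero_iff.1 (by linarith))
  have hmem : -gprojS e T z ∈ SigmaK e G K := by
    rw [← neg_one_smul ℝ]
    exact smul_mem_SigmaK (gprojS_mem_SigmaK he hGdisj hTG hT.le z) _
  refine le_iSup_of_le ⟨-gprojS e T z, hmem, neg_ne_zero.2 hzT⟩ (EReal.coe_le_coe_iff.2 ?_)
  refine one_div_sqrt_two_le_deltaUoS (neg_ne_zero.2 hzT) ?_ ?_
  · rw [inner_neg_left, neg_neg, norm_neg, inner_gprojS_self he hTd]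
  · rw [norm_neg, neg_add_eq_sub, ← eq_sub_of_add_eq hzsplit]
    exact coneNorm_gprojS_sdiff_le he hGdisj hK1 hKG hTG hT hσT hσ hmass hzT
end
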